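/- There exists a constant c > 0 such that for all sufficiently large integers n, λ(⌈log₂ n⌉, n) ≥ n · 2^(c · (log₂ log₂ n)²). -/

import Mathlib

/-- The alternating sequence `a, b, a, b, ...` of length `k`. -/
def altSeq {α : Type*} (a b : α) : ℕ → List α
  | 0 => []
  | k + 1 => a :: altSeq b a k

/-- `l` avoids alternations of length `k`: it has no (not necessarily contiguous)
subsequence `a, b, a, b, ...` of length `k` with `a ≠ b`. -/
def AvoidsAlt {α : Type*} (l : List α) (k : ℕ) : Prop :=
  ∀ a b : α, a ≠ b → ¬ (altSeq a b k).Sublist l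

/-- `l` is an order-`s` Davenport–Schinzel sequence over an alphabet of `n` symbols:
no two consecutive entries are equal and it avoids alternations of length `s + 2`. -/
def IsDS (s n : ℕ) (l : List (Fin n)) : Prop :=
  l.Chain' (· ≠ ·) ∧ AvoidsAlt l (s + 2)

/-- `lambdaDS s n` is the maximum length of an order-`s` Davenport–Schinzel
sequence over an alphabet of `n` symbols. -/
noncomputable def lambdaDS (s n : ℕ) : ℕ :=
  sSup { L | ∃ l : List (Fin n), IsDS s n l ∧ l.length = L }

/-- The length of the longest alternation `a, b, a, b, ...` contained in a list. -/
noncomputable def altCount {α : Type*} : List α → α → α → ℕ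
  | [], _, _ => 0
  | x :: l, a, b => open Classical in if x = a then altCount l b a + 1 else altCount l a b

/-- The length of the longest alternation between `a` and `b`, starting with either symbol. -/
noncomputable def altMax {α : Type*} (l : List α) (a b : α) : ℕ :=
  max (altCount l a b) (altCount l b a)

section AltCount

variable {α β ι : Type*}

theorem altCount_cons_self (l : List α) (a b : α) :
    altCount (a :: l) a b = altCount l b a + 1 := by simp [altCount]

theorem altCount_cons_of_ne (l : List α) {x a : α} (h : x ≠ a) (b : α) :
    altCount (x :: l) a b = altCount l a b := by simp [altCount, h]

theorem le_altCount_of_sublist (l : List α) (a b : α) (k : ℕ)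
    (h : (altSeq a b k).Sublist l) : k ≤ altCount l a b := by
  induction l generalizing a b k with
  | nil =>
    cases k with
    | zero => simp
    | succ k => simp [altSeq] at h
  | cons x l ih =>
    cases k with
    | zero => simp
    | succ k =>
      by_cases hx : x = a
      · subst hx
        rw [altCount_cons_self]
        rw [altSeq, List.cons_sublist_cons] at h
        exact Nat.succ_le_succ (ih _ _ _ h)
      · rw [altCount_cons_of_ne l hx]
        apply ih
        rw [altSeq] at h ⊢
        cases h with
        | cons _ h => exact h
        | cons_cons _ h => exact absurd rfl hx

theorem altSeq_sublist_of_le_altCount (l : List α) (a b : α) (k : ℕ)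
    (h : k ≤ altCount l a b) : (altSeq a b k).Sublist l := by
  induction l generalizing a b k with
  | nil =>
    obtain rfl : k = 0 := by simpa [altCount] using h
    simp [altSeq]
  | cons x l ih =>
    by_cases hx : x = a
    · subst hx
      rw [altCount_cons_self] at h
      cases k with
      | zero => simp [altSeq]
      | succ k =>
        rw [altSeq, List.cons_sublist_cons]
        exact ih _ _ _ (by omega)
    · rw [altCount_cons_of_ne l hx] at h
      exact (ih _ _ _ h).cons x

theorem altCount_le_altCount_swap (l : List α) (a b : α) :
    altCount l a b ≤ altCount l b a + 1 := by
  induction l with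
  | nil => simp [altCount]
  | cons x l ih =>
    by_cases ha : x = a <;> by_cases hb : x = b <;> simp only [altCount, ha, hb, if_true, if_false]
    · subst ha; subst hb; simp
    all_goals grind

theorem altCount_le_altCount_cons (x : α) (l : List α) (a b : α) :
    altCount l a b ≤ altCount (x :: l) a b := by
  by_cases hx : x = a
  · subst hx
    rw [altCount_cons_self]
    exact altCount_le_altCount_swap l x b
  · rw [altCount_cons_of_ne l hx]

theorem altMax_comm (l : List α) (a b : α) : altMax l a b = altMax l b a :=
  max_comm _ _

theorem altCount_append_le (l₁ l₂ : List α) (a b : α) :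
    altCount (l₁ ++ l₂) a b ≤ altCount l₁ a b + altMax l₂ a b := by
  induction l₁ generalizing a b with
  | nil => simp [altCount, altMax]
  | cons x l ih =>
    by_cases hx : x = a
    · subst hx
      rw [List.cons_append, altCount_cons_self, altCount_cons_self]
      have := ih b x
      rw [altMax_comm] at this
      omega
    · rw [List.cons_append, altCount_cons_of_ne _ hx, altCount_cons_of_ne _ hx]
      exact ih a b

theorem altMax_append_le (l₁ l₂ : List α) (a b : α) :
    altMax (l₁ ++ l₂) a b ≤ altMax l₁ a b + altMax l₂ a b := by
  have h₁ := altCount_append_le l₁ l₂ a b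
  have h₂ := altCount_append_le l₁ l₂ b a
  rw [altMax_comm l₂ b a] at h₂
  have h₃ : altCount l₁ a b ≤ altMax l₁ a b := le_max_left _ _
  have h₄ : altCount l₁ b a ≤ altMax l₁ a b := le_max_right _ _
  exact max_le (by omega) (by omega)

theorem altMax_flatMap_le (L : List ι) (f : ι → List α) (a b : α) :
    altMax (L.flatMap f) a b ≤ (L.map fun i => altMax (f i) a b).sum := by
  induction L with
  | nil => simp [altMax, altCount]
  | cons i L ih =>
    rw [List.flatMap_cons, List.map_cons, List.sum_cons]
    exact (altMax_append_le _ _ _ _).trans (Nat.add_le_add_left ih _)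

theorem altMax_flatMap_univ_le [Fintype ι] (f : ι → List α) (a b : α) :
    altMax ((Finset.univ : Finset ι).toList.flatMap f) a b ≤ ∑ i, altMax (f i) a b :=
  (altMax_flatMap_le _ _ _ _).trans (Finset.sum_map_toList _ _).le

theorem altCount_map {f : α → β} (hf : Function.Injective f) (l : List α) (a b : α) :
    altCount (l.map f) (f a) (f b) = altCount l a b := by
  induction l generalizing a b with
  | nil => simp [altCount]
  | cons x l ih =>
    by_cases hx : x = a
    · subst hx
      rw [List.map_cons, altCount_cons_self, altCount_cons_self, ih]
    · rw [List.map_cons, altCount_cons_of_ne _ hx, altCount_cons_of_ne _ (hf.ne hx), ih]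

theorem altMax_map {f : α → β} (hf : Function.Injective f) (l : List α) (a b : α) :
    altMax (l.map f) (f a) (f b) = altMax l a b := by
  simp [altMax, altCount_map hf]

theorem altCount_eq_zero_of_notMem {l : List α} {a : α} (h : a ∉ l) (b : α) :
    altCount l a b = 0 := by
  induction l with
  | nil => simp [altCount]
  | cons x l ih =>
    rw [List.mem_cons, not_or] at h
    rw [altCount_cons_of_ne l (Ne.symm h.1), ih h.2]

open Classical in
/-- A list missing `a` or `b` only contains trivial alternations of the two. -/
theorem altMax_le_of_notMem {l : List α} {a b : α} (h : ¬ (a ∈ l ∧ b ∈ l)) :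
    altMax l a b ≤ (if a ∈ l then 1 else 0) + (if b ∈ l then 1 else 0) := by
  have h₁ := altCount_le_altCount_swap l a b
  have h₂ := altCount_le_altCount_swap l b a
  have h₃ : a ∉ l → altCount l a b = 0 := fun h => altCount_eq_zero_of_notMem h b
  have h₄ : b ∉ l → altCount l b a = 0 := fun h => altCount_eq_zero_of_notMem h a
  unfold altMax
  by_cases ha : a ∈ l <;> by_cases hb : b ∈ l <;> simp_all

open Classical in
theorem altMax_le_add {l : List α} {a b : α} {A : ℕ} (h : a ∈ l → b ∈ l → altMax l a b ≤ A) :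
    altMax l a b ≤ (if a ∈ l then 1 else 0) + (if b ∈ l then 1 else 0) +
      (if a ∈ l ∧ b ∈ l then A else 0) := by
  by_cases hab : a ∈ l ∧ b ∈ l
  · have := h hab.1 hab.2
    rw [if_pos hab]
    omega
  · exact (altMax_le_of_notMem hab).trans (Nat.le_add_right _ _)

/-- Counting the longest alternations bounds the length of a list without immediate repetitions. -/
theorem length_le_sum_altCount [Fintype α] [DecidableEq α] (l : List α)
    (h : l.IsChain (· ≠ ·)) :
    l.length ≤ ∑ q ∈ (Finset.univ : Finset α).offDiag, altCount l q.1 q.2 + 1 := by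
  induction l with
  | nil => simp
  | cons x l ih =>
    cases l with
    | nil => simp
    | cons y l =>
      rw [List.isChain_cons_cons] at h
      have hlt : ∑ q ∈ (Finset.univ : Finset α).offDiag, altCount (y :: l) q.1 q.2 <
          ∑ q ∈ (Finset.univ : Finset α).offDiag, altCount (x :: y :: l) q.1 q.2 := by
        apply Finset.sum_lt_sum
        · exact fun q _ => altCount_le_altCount_cons _ _ _ _
        · refine ⟨(x, y), by simpa using h.1, ?_⟩
          rw [altCount_cons_self, altCount_cons_self, altCount_cons_of_ne _ h.1.symm]
          exact Nat.lt_succ_of_lt (Nat.lt_succ_self _)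
      have := ih h.2
      rw [List.length_cons]
      omega

end AltCount

section Lambda

theorem bddAbove_length_isDS (s n : ℕ) :
    BddAbove { L | ∃ l : List (Fin n), IsDS s n l ∧ l.length = L } := by
  refine ⟨(Finset.univ : Finset (Fin n)).offDiag.card * (s + 1) + 1, ?_⟩
  rintro L ⟨l, ⟨hc, ha⟩, rfl⟩
  refine (length_le_sum_altCount l hc).trans (Nat.add_le_add_right ?_ 1)
  rw [← smul_eq_mul]
  apply Finset.sum_le_card_nsmul
  intro q hq
  by_contra! hlt
  exact ha q.1 q.2 (by simpa using hq) (altSeq_sublist_of_le_altCount _ _ _ _ hlt)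

theorem length_le_lambdaDS {α : Type*} [Fintype α] {s n : ℕ} (hn : Fintype.card α ≤ n)
    (l : List α) (hc : l.IsChain (· ≠ ·)) (ha : ∀ a b, a ≠ b → altMax l a b ≤ s + 1) :
    l.length ≤ lambdaDS s n := by
  obtain ⟨e⟩ : Nonempty (α ↪ Fin n) :=
    Function.Embedding.nonempty_of_card_le (by simpa using hn)
  refine le_csSup (bddAbove_length_isDS s n) ⟨l.map e, ⟨?_, ?_⟩, by simp⟩
  · exact (List.isChain_map e).2 (hc.imp fun a b hab => e.injective.ne hab)
  · intro a b hab hsub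
    have hmem : a ∈ l.map e ∧ b ∈ l.map e := by
      refine ⟨hsub.subset ?_, hsub.subset ?_⟩ <;> simp [altSeq]
    obtain ⟨⟨a, -, rfl⟩, ⟨b, -, rfl⟩⟩ := And.imp List.mem_map.1 List.mem_map.1 hmem
    have h₁ := le_altCount_of_sublist _ _ _ _ hsub
    rw [altCount_map e.injective] at h₁
    have h₂ := (le_max_left _ _).trans (ha a b (by rintro rfl; exact hab rfl))
    omega

end Lambda

section Construction

/-- All cyclic repetitions of the list are free of immediate repetitions. -/
def CyclicallyReduced {α : Type*} (l : List α) : Prop :=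
  ∀ N : ℕ, (List.replicate N l).flatten.IsChain (· ≠ ·)

theorem flatten_replicate_flatten_replicate {α : Type*} (M N : ℕ) (l : List α) :
    (List.replicate M (List.replicate N l).flatten).flatten =
      (List.replicate (M * N) l).flatten := by
  induction M with
  | zero => simp
  | succ M ih =>
    rw [List.replicate_succ, List.flatten_cons, ih, Nat.succ_mul, Nat.add_comm,
      List.replicate_add, List.flatten_append]

theorem CyclicallyReduced.isChain {α : Type*} {l : List α} (h : CyclicallyReduced l) :
    l.IsChain (· ≠ ·) := by simpa using h 1

theorem CyclicallyReduced.of_map {α β : Type*} {l : List α} (f : α → β)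
    (h : CyclicallyReduced (l.map f)) : CyclicallyReduced l := by
  intro N
  have := h N
  rw [← List.map_replicate, ← List.map_flatten, List.isChain_map] at this
  exact this.imp fun a b hab => ne_of_apply_ne f hab

theorem CyclicallyReduced.flatMap {α β ι : Type*} {l : List β} (h : CyclicallyReduced l)
    (L : List ι) (f : ι → List α) (g : α → β) (hf : ∀ i, (f i).map g = l) :
    CyclicallyReduced (L.flatMap f) := by
  apply CyclicallyReduced.of_map g
  rw [List.map_flatMap]
  simp only [hf]
  rw [List.flatMap_def, List.map_const']
  intro N
  rw [flatten_replicate_flatten_replicate]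
  exact h _

theorem cyclicallyReduced_of_nodup {α : Type*} {l : List α} (h : l.Nodup) (hl : 2 ≤ l.length) :
    CyclicallyReduced l := by
  intro N
  have hne : l ≠ [] := by rintro rfl; simp at hl
  rw [List.isChain_flatten (by
    intro hmem
    exact hne (List.eq_of_mem_replicate hmem).symm)]
  refine ⟨fun l' hl' => ?_, ?_⟩
  · rw [List.eq_of_mem_replicate hl']
    exact List.Pairwise.isChain h
  · apply List.isChain_replicate_of_rel
    intro x hx y hy hxy
    rw [List.getLast?_eq_getElem?, Option.mem_def, List.getElem?_eq_some_iff] at hx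
    rw [List.head?_eq_getElem?, Option.mem_def, List.getElem?_eq_some_iff] at hy
    obtain ⟨hi, hx⟩ := hx
    obtain ⟨hj, hy⟩ := hy
    have := (h.getElem_inj_iff (hi := hi) (hj := hj)).1 (by rw [hx, hy, hxy])
    omega

theorem altCount_le_two_of_nodup {α : Type*} {l : List α} (h : l.Nodup) (a b : α) :
    altCount l a b ≤ 2 := by
  by_contra! hlt
  have := altSeq_sublist_of_le_altCount l a b 3 hlt
  simpa [altSeq] using h.sublist this

variable {p : ℕ} [Fact p.Prime] {V : Type} [AddCommGroup V] [Module (ZMod p) V]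

theorem eq_of_mem_lines {a b : V × V} (hab : a ≠ b) {x y : ZMod p} {u v : V}
    (hau : a.2 = u + x • a.1) (hbu : b.2 = u + x • b.1)
    (hav : a.2 = v + y • a.1) (hbv : b.2 = v + y • b.1) : (x, u) = (y, v) := by
  have hxy : x = y := by
    by_contra hne
    have h₀ : (x - y) • (a.1 - b.1) = 0 := by
      have h₁ : x • a.1 - x • b.1 = a.2 - b.2 := by rw [hau, hbu]; abel
      have h₂ : y • a.1 - y • b.1 = a.2 - b.2 := by rw [hav, hbv]; abel
      rw [sub_smul, smul_sub, smul_sub, h₁, h₂, sub_self]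
    have h₁ : a.1 = b.1 := by
      rcases smul_eq_zero.1 h₀ with h | h
      · exact absurd (sub_eq_zero.1 h) hne
      · exact sub_eq_zero.1 h
    exact hab (Prod.ext h₁ (by rw [hau, hbu, h₁]))
  subst hxy
  rw [hau] at hav
  rw [add_right_cancel hav]

variable [Fintype V]

/-- The concatenation of copies of `l` along all non-vertical lines of `V × V` with slope in
`ZMod p`. -/
noncomputable def lineSeq (p : ℕ) [Fact p.Prime] {V : Type} [Fintype V] [AddCommGroup V]
    [Module (ZMod p) V] (l : List V) : List (V × V) :=
  (Finset.univ : Finset (ZMod p × V)).toList.flatMap fun i => l.map fun u => (u, i.2 + i.1 • u)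

theorem length_lineSeq (l : List V) :
    (lineSeq p l).length = p * Fintype.card V * l.length := by
  simp [lineSeq, List.length_flatMap, ZMod.card]

theorem cyclicallyReduced_lineSeq {l : List V} (h : CyclicallyReduced l) :
    CyclicallyReduced (lineSeq p l) :=
  h.flatMap _ _ Prod.fst fun i => by simp [Function.comp_def]

open Classical in
theorem sum_mem_line_le (l : List V) (a : V × V) :
    (∑ i : ZMod p × V, if a ∈ l.map (fun u => (u, i.2 + i.1 • u)) then 1 else 0) ≤ p := by
  rw [Fintype.sum_prod_type]
  calc _ ≤ ∑ _x : ZMod p, 1 := by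
        refine Finset.sum_le_sum fun x _ => ?_
        rw [Finset.sum_boole]
        simp only [Nat.cast_id]
        refine Finset.card_le_one.2 fun u hu v hv => ?_
        simp only [Finset.mem_filter, Finset.mem_univ, true_and, List.mem_map] at hu hv
        obtain ⟨c, -, rfl⟩ := hu
        obtain ⟨d, -, hd⟩ := hv
        obtain ⟨rfl, hd⟩ := Prod.mk.inj hd
        exact (add_right_cancel hd).symm
    _ = p := by simp [ZMod.card]

theorem altMax_lineSeq_le {l : List V} {A : ℕ} (h : ∀ a b, a ≠ b → altMax l a b ≤ A)
    (a b : V × V) (hab : a ≠ b) : altMax (lineSeq p l) a b ≤ 2 * p + A := by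
  classical
  refine (altMax_flatMap_univ_le _ _ _).trans ?_
  have hinj : ∀ i : ZMod p × V, Function.Injective fun u : V => (u, i.2 + i.1 • u) :=
    fun i u v huv => (Prod.mk.inj huv).1
  have hle : ∀ i : ZMod p × V, altMax (l.map fun u => (u, i.2 + i.1 • u)) a b ≤
      (if a ∈ l.map (fun u => (u, i.2 + i.1 • u)) then 1 else 0) +
      (if b ∈ l.map (fun u => (u, i.2 + i.1 • u)) then 1 else 0) +
      (if a ∈ l.map (fun u => (u, i.2 + i.1 • u)) ∧ b ∈ l.map (fun u => (u, i.2 + i.1 • u))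
        then A else 0) := by
    intro i
    convert altMax_le_add (A := A) fun ha hb => ?_
    obtain ⟨a, -, rfl⟩ := List.mem_map.1 ha
    obtain ⟨b, -, rfl⟩ := List.mem_map.1 hb
    rw [altMax_map (hinj i)]
    exact h a b (by rintro rfl; exact hab rfl)
  refine (Finset.sum_le_sum fun i _ => hle i).trans ?_
  rw [Finset.sum_add_distrib, Finset.sum_add_distrib]
  have h₁ := sum_mem_line_le (p := p) l a
  have h₂ := sum_mem_line_le (p := p) l b
  have h₃ : (∑ i : ZMod p × V, if a ∈ l.map (fun u => (u, i.2 + i.1 • u)) ∧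
      b ∈ l.map (fun u => (u, i.2 + i.1 • u)) then A else 0) ≤ A := by
    rw [← Finset.sum_filter, Finset.sum_const, smul_eq_mul]
    refine (Nat.mul_le_mul_right A (Finset.card_le_one.2 ?_)).trans (one_mul A).le
    rintro ⟨x, u⟩ hu ⟨y, v⟩ hv
    simp only [Finset.mem_filter, Finset.mem_univ, true_and, List.mem_map] at hu hv
    obtain ⟨⟨_, -, ha⟩, ⟨_, -, hb⟩⟩ := hu
    obtain ⟨⟨_, -, ha'⟩, ⟨_, -, hb'⟩⟩ := hv
    apply eq_of_mem_lines hab <;> grind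
  omega

/-- The sequences obtained by iterating `lineSeq`. -/
theorem exists_iterated_lineSeq (p : ℕ) [Fact p.Prime] (k : ℕ) :
    ∃ (V : Type) (_ : Fintype V) (_ : AddCommGroup V) (_ : Module (ZMod p) V) (l : List V),
      Fintype.card V = p ^ 2 ^ k ∧ l.length = p ^ 2 ^ k * p ^ k ∧ CyclicallyReduced l ∧
        ∀ a b, a ≠ b → altMax l a b ≤ 2 * p * k + 2 := by
  induction k with
  | zero =>
    refine ⟨ZMod p, inferInstance, inferInstance, inferInstance, Finset.univ.toList, ?_, ?_, ?_, ?_⟩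
    · simp [ZMod.card]
    · simp [ZMod.card]
    · refine cyclicallyReduced_of_nodup (Finset.nodup_toList _) ?_
      simpa [ZMod.card] using (Fact.out : p.Prime).two_le
    · intro a b _
      have h := Finset.nodup_toList (Finset.univ : Finset (ZMod p))
      exact max_le (altCount_le_two_of_nodup h a b) (altCount_le_two_of_nodup h b a)
  | succ k ih =>
    obtain ⟨V, _, _, _, l, hV, hl, hc, ha⟩ := ih
    refine ⟨V × V, inferInstance, inferInstance, inferInstance, lineSeq p l, ?_, ?_,
      cyclicallyReduced_lineSeq hc, fun a b hab => (altMax_lineSeq_le ha a b hab).trans ?_⟩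
    · rw [Fintype.card_prod, hV, pow_succ 2, pow_mul, sq]
    · rw [length_lineSeq, hV, hl, pow_succ 2, pow_mul, sq, pow_succ]
      ring
    · exact le_of_eq (by ring)

/-- Concatenating copies over disjoint alphabets does not create long alternations. -/
theorem altMax_copies_le {α : Type*} {l : List α} {A : ℕ} (hA : 2 ≤ A)
    (h : ∀ a b, a ≠ b → altMax l a b ≤ A) (c : ℕ) (a b : Fin c × α) (hab : a ≠ b) :
    altMax ((Finset.univ : Finset (Fin c)).toList.flatMap fun i => l.map (Prod.mk i)) a b ≤ A := by
  classical
  refine (altMax_flatMap_univ_le _ _ _).trans ?_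
  obtain ⟨i, a⟩ := a
  obtain ⟨j, b⟩ := b
  have hmem : ∀ (t i : Fin c) (a : α), (i, a) ∈ l.map (Prod.mk t) → t = i := by
    rintro t i a ha
    obtain ⟨_, -, h⟩ := List.mem_map.1 ha
    exact (Prod.mk.inj h).1
  by_cases hij : i = j
  · subst hij
    rw [Finset.sum_eq_single i]
    · rw [altMax_map (Prod.mk_right_injective i)]
      exact h a b (by rintro rfl; exact hab rfl)
    · intro t _ ht
      have h₁ : ∀ a, (i, a) ∉ l.map (Prod.mk t) := fun a ha => ht (hmem _ _ _ ha)
      simp only [altMax, altCount_eq_zero_of_notMem (h₁ _), max_self]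
    · simp
  · calc _ ≤ ∑ t : Fin c, ((if t = i then 1 else 0) + (if t = j then 1 else 0)) := by
          refine Finset.sum_le_sum fun t _ => ?_
          refine (altMax_le_of_notMem fun hh => ?_).trans (Nat.add_le_add ?_ ?_)
          · exact hij ((hmem _ _ _ hh.1).symm.trans (hmem _ _ _ hh.2))
          · have := hmem t i a
            split_ifs <;> simp_all
          · have := hmem t j b
            split_ifs <;> simp_all
      _ = 2 := by simp [Finset.sum_add_distrib]
      _ ≤ A := hA

theorem mul_pow_le_two_mul_lambdaDS {p k s n : ℕ} (hp : p.Prime) (hn : p ^ 2 ^ k ≤ n)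
    (hs : 2 * p * k < s) : n * p ^ k ≤ 2 * lambdaDS s n := by
  have := Fact.mk hp
  obtain ⟨V, _, _, _, l, hV, hl, hc, ha⟩ := exists_iterated_lineSeq p k
  have hpos : 0 < p ^ 2 ^ k := pow_pos hp.pos _
  have hlen := length_le_lambdaDS (s := s) (n := n) (α := Fin (n / p ^ 2 ^ k) × V)
    (by
      rw [Fintype.card_prod, Fintype.card_fin, hV]
      exact Nat.div_mul_le_self _ _)
    ((Finset.univ : Finset (Fin (n / p ^ 2 ^ k))).toList.flatMap fun i => l.map (Prod.mk i))
    (hc.flatMap _ _ Prod.snd fun i => by simp [Function.comp_def]).isChain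
    (fun a b hab => (altMax_copies_le (by omega) ha _ a b hab).trans (by omega))
  simp only [List.length_flatMap, List.length_map, List.map_const', List.sum_replicate,
    Finset.length_toList, Finset.card_univ, Fintype.card_fin, hl, smul_eq_mul] at hlen
  have hdiv : n ≤ 2 * (n / p ^ 2 ^ k * p ^ 2 ^ k) := by
    have h₁ := Nat.div_add_mod' n (p ^ 2 ^ k)
    have h₂ := Nat.mod_lt n hpos
    have h₃ : 1 * p ^ 2 ^ k ≤ n / p ^ 2 ^ k * p ^ 2 ^ k :=
      Nat.mul_le_mul_right _ ((Nat.one_le_div_iff hpos).2 hn)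
    omega
  calc n * p ^ k ≤ 2 * (n / p ^ 2 ^ k * p ^ 2 ^ k) * p ^ k := Nat.mul_le_mul_right _ hdiv
    _ = 2 * (n / p ^ 2 ^ k * (p ^ 2 ^ k * p ^ k)) := by ring
    _ ≤ 2 * lambdaDS s n := Nat.mul_le_mul_left _ hlen

end Construction

theorem mul_two_pow_le_two_mul_lambdaDS {q s n : ℕ} (hq : 2 ≤ q) (hn : 2 ^ 2 ^ (4 * q) ≤ n)
    (hs : 2 ^ (4 * q) ≤ s) : n * 2 ^ (2 * q ^ 2) ≤ 2 * lambdaDS s n := by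
  obtain ⟨p, hp, hlt, hle⟩ := Nat.exists_prime_lt_and_le_two_mul (2 ^ q) (by positivity)
  have hlt' : q < 2 ^ q := Nat.lt_two_pow_self
  have h4 : 4 ≤ 2 ^ q := Nat.pow_le_pow_right (n := 2) two_pos hq
  have hpow : 2 ^ (4 * q) = 2 ^ q * 2 ^ q * (2 ^ q * 2 ^ q) := by ring
  have hle' : p ≤ 2 ^ (q + 1) := by rw [pow_succ]; omega
  refine le_trans ?_ (mul_pow_le_two_mul_lambdaDS (k := 2 * q) hp (le_trans ?_ hn) (hs.trans_lt' ?_))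
  · refine Nat.mul_le_mul_left _ ?_
    calc 2 ^ (2 * q ^ 2) = (2 ^ q) ^ (2 * q) := by rw [← pow_mul]; ring_nf
      _ ≤ p ^ (2 * q) := Nat.pow_le_pow_left hlt.le _
  · calc p ^ 2 ^ (2 * q) ≤ (2 ^ (q + 1)) ^ 2 ^ (2 * q) := Nat.pow_le_pow_left hle' _
      _ = 2 ^ ((q + 1) * 2 ^ (2 * q)) := by rw [← pow_mul]
      _ ≤ 2 ^ (2 ^ (2 * q) * 2 ^ (2 * q)) := by
        refine Nat.pow_le_pow_right two_pos (Nat.mul_le_mul_right _ ?_)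
        exact hlt'.trans_le (Nat.pow_le_pow_right two_pos (by omega))
      _ = 2 ^ 2 ^ (4 * q) := by rw [← pow_add]; ring_nf
  · calc 2 * p * (2 * q) ≤ 2 * (2 * 2 ^ q) * (2 * q) := by gcongr
      _ < 2 * (2 * 2 ^ q) * (2 * 2 ^ q) := by gcongr
      _ = 2 ^ q * 2 ^ q * 8 := by ring
      _ ≤ 2 ^ q * 2 ^ q * (2 ^ q * 2 ^ q) := Nat.mul_le_mul_left _ (by nlinarith)
      _ = 2 ^ (4 * q) := hpow.symm

theorem stmt13 :
    ∃ c : ℝ, 0 < c ∧ ∃ N : ℕ, ∀ n : ℕ, N ≤ n →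
      (n : ℝ) * 2 ^ (c * (Real.logb 2 (Real.logb 2 n)) ^ 2) ≤
        (lambdaDS ⌈Real.logb 2 n⌉₊ n : ℝ) := by
  refine ⟨1 / 32, by norm_num, 2 ^ 2 ^ 12, fun n hn => ?_⟩
  obtain ⟨m, hm⟩ : ∃ m, m = Nat.log 2 n := ⟨_, rfl⟩
  obtain ⟨q, hqdef⟩ : ∃ q, q = Nat.log 2 m / 4 := ⟨_, rfl⟩
  have hn0 : n ≠ 0 := by
    rintro rfl
    exact absurd hn (Nat.not_le.2 (Nat.pow_pos two_pos))
  have hm12 : 2 ^ 12 ≤ m := hm ▸ Nat.le_log_of_pow_le one_lt_two hn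
  have hm0 : m ≠ 0 := by omega
  have hl12 : 12 ≤ Nat.log 2 m := Nat.le_log_of_pow_le one_lt_two hm12
  have hq : 3 ≤ q := by omega
  have hqm : 2 ^ (4 * q) ≤ m :=
    (Nat.pow_le_pow_right two_pos (by omega)).trans (Nat.pow_log_le_self 2 hm0)
  have hmn : 2 ^ m ≤ n := hm ▸ Nat.pow_log_le_self 2 hn0
  have hmlog : (m : ℝ) ≤ Real.logb 2 n := by
    rw [Real.le_logb_iff_rpow_le one_lt_two (by positivity), Real.rpow_natCast]
    exact_mod_cast hmn
  have hlog : Real.logb 2 n ≤ 2 ^ (4 * q + 4) := by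
    have h₁ : n < 2 ^ (m + 1) := hm ▸ Nat.lt_pow_succ_log_self one_lt_two n
    have h₂ : m < 2 ^ (4 * q + 4) :=
      (Nat.lt_pow_succ_log_self one_lt_two m).trans_le (Nat.pow_le_pow_right two_pos (by omega))
    have h₃ : n ≤ 2 ^ 2 ^ (4 * q + 4) := h₁.le.trans (Nat.pow_le_pow_right two_pos h₂)
    rw [Real.logb_le_iff_le_rpow one_lt_two (by positivity)]
    have h₄ : ((2 : ℝ) ^ (4 * q + 4)) = ((2 ^ (4 * q + 4) : ℕ) : ℝ) := by push_cast; rfl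
    rw [h₄, Real.rpow_natCast]
    exact_mod_cast h₃
  have hlog1 : 1 ≤ Real.logb 2 n := le_trans (by exact_mod_cast Nat.one_le_iff_ne_zero.2 hm0) hmlog
  have hL0 : 0 ≤ Real.logb 2 (Real.logb 2 n) := Real.logb_nonneg one_lt_two hlog1
  have hL : Real.logb 2 (Real.logb 2 n) ≤ 4 * q + 4 := by
    rw [Real.logb_le_iff_le_rpow one_lt_two (by positivity)]
    exact_mod_cast hlog
  have hmain := mul_two_pow_le_two_mul_lambdaDS (q := q) (s := ⌈Real.logb 2 n⌉₊) (n := n)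
    (by omega) ((Nat.pow_le_pow_right two_pos hqm).trans hmn)
    (hqm.trans (by exact_mod_cast hmlog.trans (Nat.le_ceil _)))
  have hexp : 1 / 32 * Real.logb 2 (Real.logb 2 n) ^ 2 ≤ ((2 * q ^ 2 : ℕ) : ℝ) - 1 := by
    have hq' : (3 : ℝ) ≤ q := by exact_mod_cast hq
    have hsq : Real.logb 2 (Real.logb 2 n) ^ 2 ≤ (4 * q + 4 : ℝ) ^ 2 := by gcongr
    push_cast
    nlinarith
  calc (n : ℝ) * 2 ^ (1 / 32 * Real.logb 2 (Real.logb 2 n) ^ 2)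
      ≤ n * 2 ^ (((2 * q ^ 2 : ℕ) : ℝ) - 1) := by
        gcongr
        exact one_le_two
    _ = n * 2 ^ (2 * q ^ 2) / 2 := by
        rw [Real.rpow_sub_one two_ne_zero, Real.rpow_natCast, mul_div_assoc]
    _ ≤ lambdaDS ⌈Real.logb 2 n⌉₊ n := by
        rw [div_le_iff₀ two_pos, mul_comm (lambdaDS _ _ : ℝ)]
        exact_mod_cast hmain
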